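/- Let F₁, …, F_K be jointly irreducible probability distributions, let η₁, η₂ ∈ Δ_K with η₁ ≠ η₂, and let Q_i = ∑_{k=1}^K η_{i,k} F_k for i = 1, 2. Let R be the residue of Q₁ with respect to Q₂ and write R = ∑_{k=1}^K μ_k F_k with μ ∈ Δ_K. Then μ lies on the relative boundary of Δ_K; that is, min_{k} μ_k = 0. -/

import Mathlib

open MeasureTheory

/-- Probability distributions `P₁, …, P_L` are *jointly irreducible* if whenever a real linear
combination `∑ γᵢ Pᵢ` (in the space of finite signed measures) is a probability distribution,
all coefficients `γᵢ` are nonnegative. -/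
def JointlyIrreducible {X : Type*} [MeasurableSpace X] {L : ℕ}
    (P : Fin L → Measure X) [∀ j, IsProbabilityMeasure (P j)] : Prop :=
  ∀ (γ : Fin L → ℝ) (Q : Measure X) (_ : IsProbabilityMeasure Q),
    Q.toSignedMeasure = ∑ i, γ i • (P i).toSignedMeasure → ∀ i, 0 ≤ γ i

/-- The two-sample operator
`κ*(F₀ | F₁) = sup {κ ∈ [0,1] : ∃ probability G, F₀ = (1−κ)G + κF₁}`. -/
noncomputable def kappaTwo {X : Type*} [MeasurableSpace X]
    (F₀ F₁ : Measure X) [IsFiniteMeasure F₀] [IsFiniteMeasure F₁] : ℝ :=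
  sSup {κ : ℝ | κ ∈ Set.Icc (0 : ℝ) 1 ∧ ∃ (G : Measure X) (_ : IsProbabilityMeasure G),
    F₀.toSignedMeasure = (1 - κ) • G.toSignedMeasure + κ • F₁.toSignedMeasure}

/-- Convex weights on a finite family of probability measures give a probability measure. -/
lemma exists_isProbabilityMeasure_toSignedMeasure_eq_sum {X ι : Type*} [MeasurableSpace X]
    [Fintype ι] (F : ι → Measure X) [∀ k, IsProbabilityMeasure (F k)]
    {ν : ι → ℝ} (hν : ν ∈ stdSimplex ℝ ι) :
    ∃ (G : Measure X) (_ : IsProbabilityMeasure G),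
      G.toSignedMeasure = ∑ k, ν k • (F k).toSignedMeasure := by
  have hG : IsProbabilityMeasure (∑ k, ENNReal.ofReal (ν k) • F k) := by
    constructor
    simp [← ENNReal.ofReal_sum_of_nonneg fun k _ ↦ hν.1 k, hν.2]
  refine ⟨_, hG, ?_⟩
  ext s hs
  rw [Measure.toSignedMeasure_apply_measurable hs, measureReal_def, Measure.finsetSum_apply,
    ENNReal.toReal_sum fun k _ ↦ by simp [ENNReal.mul_eq_top], FunLike.coe_sum]
  simp [Measure.toSignedMeasure_apply_measurable hs, measureReal_def,
    ENNReal.toReal_ofReal (hν.1 _)]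

lemma JointlyIrreducible.linearIndependent {X : Type*} [MeasurableSpace X] {L : ℕ}
    {P : Fin L → Measure X} [∀ j, IsProbabilityMeasure (P j)] (h : JointlyIrreducible P) :
    LinearIndependent ℝ fun k ↦ (P k).toSignedMeasure := by
  rw [Fintype.linearIndependent_iff]
  intro c hc i
  by_contra hi
  have key := h (fun k ↦ (Pi.single i 1 : Fin L → ℝ) k + (-2 / c i) * c k) (P i) inferInstance (by
    simp [add_smul, mul_smul, Finset.sum_add_distrib, ← Finset.smul_sum, hc, Pi.single_apply]) i
  rw [div_mul_cancel₀ _ hi, Pi.single_eq_same] at key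
  norm_num at key

lemma kappaTwo_nonneg {X : Type*} [MeasurableSpace X] (F₀ F₁ : Measure X)
    [IsFiniteMeasure F₀] [IsFiniteMeasure F₁] : 0 ≤ kappaTwo F₀ F₁ :=
  Real.sSup_nonneg fun _ h ↦ h.1.1

lemma kappaTwo_le_one {X : Type*} [MeasurableSpace X] (F₀ F₁ : Measure X)
    [IsFiniteMeasure F₀] [IsFiniteMeasure F₁] : kappaTwo F₀ F₁ ≤ 1 :=
  Real.sSup_le (fun _ h ↦ h.1.2) zero_le_one

lemma le_kappaTwo {X : Type*} [MeasurableSpace X] {F₀ F₁ : Measure X}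
    [IsFiniteMeasure F₀] [IsFiniteMeasure F₁] {κ : ℝ} (h0 : 0 ≤ κ) (h1 : κ ≤ 1)
    (G : Measure X) [hG : IsProbabilityMeasure G]
    (h : F₀.toSignedMeasure = (1 - κ) • G.toSignedMeasure + κ • F₁.toSignedMeasure) :
    κ ≤ kappaTwo F₀ F₁ :=
  le_csSup ⟨1, fun _ h ↦ h.1.2⟩ ⟨⟨h0, h1⟩, G, hG, h⟩

/-- If `R` is the residue of `Q₁` with respect to `Q₂`, where `Q₁ ≠ Q₂` are
simplex combinations of jointly irreducible `F₁, …, F_K`, and `R = ∑ₖ μ k • F k` with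
`μ ∈ Δ_K`, then `μ` lies on the relative boundary of `Δ_K`, i.e. some coordinate of `μ`
vanishes (`min_k μ_k = 0`). -/
theorem stmt7 {X : Type*} [MeasurableSpace X] {K : ℕ}
    (F : Fin K → Measure X) [∀ k, IsProbabilityMeasure (F k)]
    (hJI : JointlyIrreducible F)
    (η₁ η₂ : Fin K → ℝ) (hη₁ : η₁ ∈ stdSimplex ℝ (Fin K)) (hη₂ : η₂ ∈ stdSimplex ℝ (Fin K))
    (hne : η₁ ≠ η₂)
    (Q₁ Q₂ : Measure X) [IsProbabilityMeasure Q₁] [IsProbabilityMeasure Q₂]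
    (hQ₁ : Q₁.toSignedMeasure = ∑ k, η₁ k • (F k).toSignedMeasure)
    (hQ₂ : Q₂.toSignedMeasure = ∑ k, η₂ k • (F k).toSignedMeasure)
    (R : Measure X) [IsProbabilityMeasure R]
    (hR : Q₁.toSignedMeasure = (1 - kappaTwo Q₁ Q₂) • R.toSignedMeasure
      + kappaTwo Q₁ Q₂ • Q₂.toSignedMeasure)
    (μ : Fin K → ℝ) (hμ : μ ∈ stdSimplex ℝ (Fin K))
    (hRμ : R.toSignedMeasure = ∑ k, μ k • (F k).toSignedMeasure) :
    ∃ k, μ k = 0 := by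
  by_contra! hμ0
  have hpos k : 0 < μ k := (hμ.1 k).lt_of_ne' (hμ0 k)
  have hle2 k : η₂ k ≤ 1 := (mem_Icc_of_mem_stdSimplex hη₂ k).2
  have h0 := kappaTwo_nonneg Q₁ Q₂
  have h1 : kappaTwo Q₁ Q₂ < 1 := by
    refine (kappaTwo_le_one Q₁ Q₂).lt_of_ne fun h ↦ hne ?_
    rw [h, sub_self, zero_smul, one_smul, zero_add, hQ₁, hQ₂] at hR
    refine funext fun k ↦ sub_eq_zero.1 <|
      Fintype.linearIndependent_iff.1 hJI.linearIndependent (η₁ - η₂) ?_ k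
    simp [sub_smul, hR]
  obtain ⟨m, hm0, hm1, hm⟩ : ∃ m : ℝ, 0 < m ∧ m < 1 ∧ ∀ k, m ≤ μ k := by
    have : Nonempty (Fin K) := by
      by_contra hK
      rw [not_nonempty_iff] at hK
      simpa using hμ.2
    obtain ⟨i, hi⟩ := Finite.exists_min μ
    have := (mem_Icc_of_mem_stdSimplex hμ i).2
    exact ⟨μ i / 2, by linarith [hpos i], by linarith, fun k ↦ by linarith [hi k, hpos i]⟩
  have hm' : 0 < 1 - m := by linarith
  have hν : (fun k ↦ (1 - m)⁻¹ * (μ k - m * η₂ k)) ∈ stdSimplex ℝ (Fin K) := by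
    refine ⟨fun k ↦ mul_nonneg (by positivity) ?_, ?_⟩
    · nlinarith [hm k, hle2 k]
    · rw [← Finset.mul_sum, Finset.sum_sub_distrib, ← Finset.mul_sum, hμ.2, hη₂.2, mul_one,
        inv_mul_cancel₀ hm'.ne']
  obtain ⟨G, hG, hGeq⟩ := exists_isProbabilityMeasure_toSignedMeasure_eq_sum F hν
  have hRG : R.toSignedMeasure = (1 - m) • G.toSignedMeasure + m • Q₂.toSignedMeasure := by
    rw [hRμ, hGeq, hQ₂, Finset.smul_sum, Finset.smul_sum, ← Finset.sum_add_distrib]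
    refine Finset.sum_congr rfl fun k _ ↦ ?_
    rw [smul_smul, smul_smul, ← add_smul, mul_inv_cancel_left₀ hm'.ne', sub_add_cancel]
  have hlt : kappaTwo Q₁ Q₂ + (1 - kappaTwo Q₁ Q₂) * m ≤ kappaTwo Q₁ Q₂ := by
    refine le_kappaTwo (by nlinarith) (by nlinarith) G ?_
    rw [hR, hRG]
    module
  nlinarith
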